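/- Let A = {(diag(a,1/a), 0) : a > 0} ⊂ G and V_0 = {(I,(t,0)) : t ∈ ℝ} ⊂ G. Let v_n = (α_n, β_n) ∈ ℝ² with |α_n| → ∞ and β_n/α_n → 0. Then (I,v_n) A (I,v_n)⁻¹ → V_0 in the Chabauty sense. -/

import Mathlib

open Matrix Filter Topology

/-- `SL2` is the special linear group `SL(2,ℝ)`. -/
abbrev SL2 : Type := Matrix.SpecialLinearGroup (Fin 2) ℝ

/-- `M2` is the space of 2×2 real matrices. -/
abbrev M2 : Type := Matrix (Fin 2) (Fin 2) ℝ

noncomputable instance : TopologicalSpace SL2 :=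
  TopologicalSpace.induced (fun g => (g : M2)) inferInstance

/-- Chabauty-sense convergence of a sequence of subsets of a topological space `X`:
(i) every point of the limit is a limit of a sequence of points of the `H n`;
(ii) every convergent sequence `x (k n) ∈ H (k n)` along a strictly increasing sequence
of indices has its limit in `L`. -/
def ChabautyTendsto {X : Type*} [TopologicalSpace X] (H : ℕ → Set X) (L : Set X) : Prop :=
  (∀ h ∈ L, ∃ u : ℕ → X, (∀ n, u n ∈ H n) ∧ Filter.Tendsto u Filter.atTop (nhds h)) ∧
  (∀ k : ℕ → ℕ, StrictMono k → ∀ x : ℕ → X, (∀ n, x n ∈ H (k n)) →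
    ∀ l : X, Filter.Tendsto x Filter.atTop (nhds l) → l ∈ L)

/-- Conjugate `x S x⁻¹` of a subset `S` of a group by a group element `x`. -/
def conjSet {X : Type*} [Group X] (x : X) (S : Set X) : Set X :=
  (fun s => x * s * x⁻¹) '' S

/-- The group `G = SL(2,ℝ) ⋉ ℝ²`: elements are pairs `(g, v)`. -/
structure GSL : Type where
  g : SL2
  v : Fin 2 → ℝ

namespace GSL

noncomputable instance : TopologicalSpace GSL :=
  TopologicalSpace.induced (fun p => (p.g, p.v)) inferInstance

/-- Multiplication `(g,v)(g',v') = (gg', v + g·v')`. -/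
noncomputable instance : Mul GSL :=
  ⟨fun p q => ⟨p.g * q.g, p.v + (p.g : M2) *ᵥ q.v⟩⟩

noncomputable instance : One GSL := ⟨⟨1, 0⟩⟩

noncomputable instance : Inv GSL :=
  ⟨fun p => ⟨p.g⁻¹, -((↑(p.g⁻¹) : M2) *ᵥ p.v)⟩⟩

@[simp] lemma mul_def (p q : GSL) :
    p * q = ⟨p.g * q.g, p.v + (p.g : M2) *ᵥ q.v⟩ := rfl

@[simp] lemma one_def : (1 : GSL) = ⟨1, 0⟩ := rfl

@[simp] lemma inv_def (p : GSL) :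
    p⁻¹ = ⟨p.g⁻¹, -((↑(p.g⁻¹) : M2) *ᵥ p.v)⟩ := rfl

noncomputable instance : Group GSL where
  mul_assoc a b c := by
    simp only [mul_def, GSL.mk.injEq]
    refine ⟨mul_assoc _ _ _, ?_⟩
    simp only [Matrix.SpecialLinearGroup.coe_mul, Matrix.mulVec_add, Matrix.mulVec_mulVec, add_assoc]
  one_mul a := by
    simp only [one_def, mul_def, GSL.mk.injEq]
    simp
  mul_one a := by
    simp only [one_def, mul_def, GSL.mk.injEq]
    simp
  inv_mul_cancel a := by
    simp only [inv_def, mul_def, one_def, GSL.mk.injEq]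
    exact ⟨inv_mul_cancel _, neg_add_cancel _⟩

end GSL

/-- The unipotent matrix `(1, s; 0, 1)` as an element of `SL(2,ℝ)`. -/
noncomputable def sMat (s : ℝ) : SL2 :=
  ⟨!![1, s; 0, 1], by simp [Matrix.det_fin_two_of]⟩

/-- The diagonal matrix `diag(a, 1/a)` as an element of `SL(2,ℝ)` (for `a ≠ 0`). -/
noncomputable def aMat (a : ℝ) (ha : a ≠ 0) : SL2 :=
  ⟨!![a, 0; 0, a⁻¹], by simp [Matrix.det_fin_two_of, mul_inv_cancel₀ ha]⟩

/-- The diagonal subgroup `A = {(diag(a, 1/a), 0) : a > 0}` of `G`. -/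
def Aset : Set GSL := {p | (∃ a : ℝ, 0 < a ∧ (p.g : M2) = !![a, 0; 0, a⁻¹]) ∧ p.v = 0}

/-- The subgroup `V_c = {(I, (t, c t)) : t ∈ ℝ}` of `G`. -/
def Vc (c : ℝ) : Set GSL := {p | p.g = 1 ∧ ∃ t : ℝ, p.v = ![t, c * t]}

lemma GSL.tendsto_iff (x : ℕ → GSL) (l : GSL) :
    Tendsto x atTop (𝓝 l) ↔
      (∀ i j, Tendsto (fun n => ((x n).g : M2) i j) atTop (𝓝 ((l.g : M2) i j))) ∧
      (∀ i, Tendsto (fun n => (x n).v i) atTop (𝓝 (l.v i))) := by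
  have h1 : Topology.IsInducing (fun p : GSL => (p.g, p.v)) := ⟨rfl⟩
  have h2 : Topology.IsInducing (fun g : SL2 => (g : M2)) := ⟨rfl⟩
  rw [h1.tendsto_nhds_iff, Prod.tendsto_iff, h2.tendsto_nhds_iff]
  refine and_congr ?_ tendsto_pi_nhds
  refine tendsto_pi_nhds.trans ?_
  exact forall_congr' fun i => tendsto_pi_nhds

lemma mem_conj_iff (a b : ℝ) (p : GSL) :
    p ∈ conjSet (⟨1, ![a, b]⟩ : GSL) Aset ↔
      ∃ c : ℝ, 0 < c ∧ (p.g : M2) = !![c, 0; 0, c⁻¹] ∧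
        p.v = ![(1 - c) * a, (1 - c⁻¹) * b] := by
  have key : ∀ (c : ℝ) (g : SL2), (g : M2) = !![c, 0; 0, c⁻¹] →
      (⟨1, ![a, b]⟩ : GSL) * ⟨g, 0⟩ * (⟨1, ![a, b]⟩ : GSL)⁻¹
        = ⟨g, ![(1 - c) * a, (1 - c⁻¹) * b]⟩ := by
    intro c g hg
    simp only [GSL.mul_def, GSL.inv_def, GSL.mk.injEq]
    refine ⟨by simp, ?_⟩
    ext i
    fin_cases i <;> simp [hg, Matrix.mulVec, dotProduct, Fin.sum_univ_two] <;> ring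
  constructor
  · rintro ⟨⟨g, v⟩, ⟨⟨c, hc, hg⟩, hv⟩, rfl⟩
    simp only at hg hv
    subst hv
    refine ⟨c, hc, ?_⟩
    simp only [key c g hg]
    exact ⟨hg, trivial⟩
  · rintro ⟨c, hc, hg, hv⟩
    refine ⟨⟨p.g, 0⟩, ⟨⟨c, hc, hg⟩, rfl⟩, ?_⟩
    simp only [key c p.g hg, ← hv]

/-- If `vₙ = (αₙ, βₙ)` with `|αₙ| → ∞` and `βₙ/αₙ → 0`, then
`(I,vₙ) A (I,vₙ)⁻¹ → V₀` in the Chabauty sense. -/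
theorem diagonal_conj_tendsto_V0 (α β : ℕ → ℝ)
    (hα : Tendsto (fun n => |α n|) atTop atTop)
    (hr : Tendsto (fun n => β n / α n) atTop (𝓝 0)) :
    ChabautyTendsto (fun n => conjSet (⟨1, ![α n, β n]⟩ : GSL) Aset) (Vc 0) := by
  have hinv : Tendsto (fun n => (α n)⁻¹) atTop (𝓝 0) := by
    rw [tendsto_zero_iff_abs_tendsto_zero]
    refine (tendsto_inv_atTop_zero.comp hα).congr fun n => ?_
    simp [abs_inv]
  have hne : ∀ᶠ n in atTop, α n ≠ 0 := by
    filter_upwards [hα.eventually_gt_atTop 0] with n hn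
    exact abs_pos.1 hn
  -- the second coordinate tends to zero as soon as the first one converges
  have second : ∀ (k : ℕ → ℕ) (c : ℕ → ℝ) (t : ℝ), Tendsto k atTop atTop → (∀ n, 0 < c n) →
      Tendsto (fun n => (1 - c n) * α (k n)) atTop (𝓝 t) →
      Tendsto c atTop (𝓝 1) ∧ Tendsto (fun n => (1 - (c n)⁻¹) * β (k n)) atTop (𝓝 0) := by
    intro k c t hk hc ht
    have hc1 : Tendsto c atTop (𝓝 1) := by
      have h := (tendsto_const_nhds (x := (1 : ℝ))).sub (ht.mul (hinv.comp hk))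
      simp only [mul_zero, sub_zero] at h
      refine h.congr' ?_
      filter_upwards [hk.eventually hne] with n hn
      simp only [Function.comp]
      field_simp
      ring
    refine ⟨hc1, ?_⟩
    have h := ((ht.mul (hr.comp hk)).mul (hc1.inv₀ one_ne_zero)).neg
    simp only [mul_zero, zero_mul, neg_zero] at h
    refine h.congr' ?_
    filter_upwards [hk.eventually hne] with n hn
    have := (hc n).ne'
    simp only [Function.comp]
    field_simp
    ring
  constructor
  · rintro ⟨g, v⟩ ⟨hg, t, hv⟩
    simp only at hg hv
    subst hg hv
    let c : ℕ → ℝ := fun n => if 0 < 1 - t * (α n)⁻¹ then 1 - t * (α n)⁻¹ else 1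
    have hc : ∀ n, 0 < c n := by
      intro n
      simp only [c]
      split_ifs with h
      · exact h
      · exact one_pos
    have hev : ∀ᶠ n in atTop, 0 < 1 - t * (α n)⁻¹ := by
      have h := (tendsto_const_nhds (x := (1 : ℝ))).sub (hinv.const_mul t)
      simp only [mul_zero, sub_zero] at h
      exact h.eventually_const_lt one_pos
    have ht : Tendsto (fun n => (1 - c n) * α n) atTop (𝓝 t) := by
      refine tendsto_const_nhds.congr' ?_
      filter_upwards [hev, hne] with n hn hn'
      simp only [c, if_pos hn]
      field_simp
      ring
    obtain ⟨hc1, h2⟩ := second id c t tendsto_id hc ht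
    refine ⟨fun n => ⟨aMat (c n) (hc n).ne', ![(1 - c n) * α n, (1 - (c n)⁻¹) * β n]⟩,
      fun n => (mem_conj_iff _ _ _).2 ⟨c n, hc n, rfl, rfl⟩, ?_⟩
    have hc2 : Tendsto (fun n => (c n)⁻¹) atTop (𝓝 1) := by
      simpa using hc1.inv₀ one_ne_zero
    rw [GSL.tendsto_iff]
    refine ⟨fun i j => ?_, fun i => ?_⟩
    · fin_cases i <;> fin_cases j <;> simp [aMat, hc1, hc2]
    · fin_cases i
      · simpa using ht
      · simpa using h2
  · intro k hk x hx l hl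
    choose c hc hg hv using fun n => (mem_conj_iff _ _ _).1 (hx n)
    rw [GSL.tendsto_iff] at hl
    obtain ⟨hlg, hlv⟩ := hl
    simp only [hg, hv] at hlg hlv
    have h0 := hlv 0
    have h1 := hlv 1
    simp only [Matrix.cons_val_zero, Matrix.cons_val_one] at h0 h1
    obtain ⟨hc1, h2⟩ := second k c _ hk.tendsto_atTop hc h0
    have hc2 : Tendsto (fun n => (c n)⁻¹) atTop (𝓝 1) := by
      simpa using hc1.inv₀ one_ne_zero
    refine ⟨?_, l.v 0, ?_⟩
    · ext i j
      refine tendsto_nhds_unique (hlg i j) ?_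
      fin_cases i <;> fin_cases j <;> simp [hc1, hc2]
    · ext i
      fin_cases i
      · simp
      · simpa using tendsto_nhds_unique h1 h2
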